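/- For all k-bounded partitions λ and μ, ⟨g^{(k)}_λ, G^{(k)}_μ⟩ = δ_{λμ}, where the Hall inner product of g^{(k)}_λ with the degree-wise finite series G^{(k)}_μ is taken term by term (only finitely many terms pair nontrivially with g^{(k)}_λ). -/

import Mathlib

open scoped Classical

namespace AffineKTheory

noncomputable instance : Nonempty YoungDiagram := ⟨⊥⟩

noncomputable instance : Nonempty YoungDiagram := ⟨⊥⟩

/-! ## Cells, hooks, cores, residues -/

/-- Hook length of the cell `(r, c)` in the diagram `γ`. -/
def hookLen (γ : YoungDiagram) (r c : ℕ) : ℕ :=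
  (γ.rowLen r - c) + (γ.colLen c - r) - 1

/-- A `p`-core: a diagram none of whose cells has hook length `p`. -/
def IsCore (p : ℕ) (γ : YoungDiagram) : Prop :=
  ∀ c : ℕ × ℕ, c ∈ γ → hookLen γ c.1 c.2 ≠ p

/-- The `(k+1)`-residue of a cell.  (Rows of the Ferrers shape are indexed so that the cell
directly above `(r, c)` -- in the Ferrers sense of the next, shorter, row -- is `(r+1, c)`.) -/
def residue (k : ℕ) (c : ℕ × ℕ) : ZMod (k + 1) :=
  (c.2 : ZMod (k + 1)) - (c.1 : ZMod (k + 1))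

/-- A removable corner of `γ`: a cell of `γ` with no cell above it nor to its right. -/
def Removable (γ : YoungDiagram) (c : ℕ × ℕ) : Prop :=
  c ∈ γ ∧ (c.1 + 1, c.2) ∉ γ ∧ (c.1, c.2 + 1) ∉ γ

/-- An addable corner of `γ`: a cell outside `γ` whose addition again yields a partition shape. -/
def Addable (γ : YoungDiagram) (c : ℕ × ℕ) : Prop :=
  c ∉ γ ∧ ∀ d : ℕ × ℕ, d ≤ c → d ≠ c → d ∈ γ

/-- A cell is `γ`-blocked if it lies below a cell of `γ`. -/
def Blocked (γ : YoungDiagram) (c : ℕ × ℕ) : Prop :=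
  (c.1 + 1, c.2) ∈ γ

/-- The number of cells of `γ` in row `i` whose hook length is at most `k`:
the `i`-th part of `𝔭(γ)`. -/
noncomputable def pRow (k : ℕ) (γ : YoungDiagram) (i : ℕ) : ℕ :=
  (γ.cells.filter (fun c => c.1 = i ∧ hookLen γ c.1 c.2 ≤ k)).card

/-- The number of cells of `γ` with `k`-bounded hook length, i.e. `|𝔭(γ)|`. -/
noncomputable def pSize (k : ℕ) (γ : YoungDiagram) : ℕ :=
  (γ.cells.filter (fun c => hookLen γ c.1 c.2 ≤ k)).card

/-- A `k`-bounded partition: all parts at most `k`. -/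
def IsKBounded (k : ℕ) (lam : YoungDiagram) : Prop :=
  ∀ i, lam.rowLen i ≤ k

/-- `𝔭(γ)`: the `k`-bounded partition obtained from a `(k+1)`-core `γ` by deleting every cell of
hook length greater than `k` and reading off row lengths. -/
noncomputable def pPart (k : ℕ) (γ : YoungDiagram) : YoungDiagram :=
  Classical.epsilon fun lam => ∀ i, lam.rowLen i = pRow k γ i

/-- `𝔠(λ)`: the unique `(k+1)`-core corresponding to the `k`-bounded partition `λ` under the
bijection `𝔭`. -/
noncomputable def coreOf (k : ℕ) (lam : YoungDiagram) : YoungDiagram :=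
  Classical.epsilon fun γ => IsCore (k + 1) γ ∧ ∀ i, pRow k γ i = lam.rowLen i

/-- The `k`-conjugate `λ^{ω_k} = 𝔭(𝔠(λ)')` of a `k`-bounded partition. -/
noncomputable def kConj (k : ℕ) (lam : YoungDiagram) : YoungDiagram :=
  pPart k ((coreOf k lam).transpose)

/-- A `k`-bounded composition: a list of parts, each between `1` and `k`. -/
def IsKBoundedComp (k : ℕ) (α : List ℕ) : Prop :=
  ∀ a ∈ α, 1 ≤ a ∧ a ≤ k

/-- Dominance order on partitions. -/
def Dominates (mu lam : YoungDiagram) : Prop :=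
  mu.card = lam.card ∧
    ∀ n : ℕ, ∑ i ∈ Finset.range n, lam.rowLen i ≤ ∑ i ∈ Finset.range n, mu.rowLen i


/-! ## Set-valued fillings and affine set-valued tableaux -/

/-- A set-valued filling of the shape `γ`: each cell of `γ` carries a finite nonempty set of
positive integers, empty outside `γ`, with `max X < min Y` when `X` is directly below `Y` and
`max X ≤ min Y` when `X` is directly to the left of `Y`. -/
def IsSVFilling (γ : YoungDiagram) (e : ℕ × ℕ → Finset ℕ) : Prop :=
  (∀ c : ℕ × ℕ, c ∈ γ ↔ (e c).Nonempty) ∧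
  (∀ c : ℕ × ℕ, ∀ x ∈ e c, 0 < x) ∧
  (∀ r c : ℕ, ∀ x ∈ e (r, c), ∀ y ∈ e (r + 1, c), x < y) ∧
  (∀ r c : ℕ, ∀ x ∈ e (r, c), ∀ y ∈ e (r, c + 1), x ≤ y)

/-- The set of cells of `T_{≤ x}`: cells containing a letter `≤ x`. -/
noncomputable def shapeLe (γ : YoungDiagram) (e : ℕ × ℕ → Finset ℕ) (x : ℕ) : Finset (ℕ × ℕ) :=
  γ.cells.filter fun c => ∃ y ∈ e c, y ≤ x

/-- A standard affine set-valued tableau of degree `n` and shape `γ`: a set-valued filling with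
letters `1, …, n` such that for each `x`, the shape of `T_{≤x}` is a `(k+1)`-core and the letter
`x` occupies exactly all of its removable corners of one single residue. -/
def IsStdASVT (k n : ℕ) (γ : YoungDiagram) (e : ℕ × ℕ → Finset ℕ) : Prop :=
  IsSVFilling γ e ∧
  (∀ c : ℕ × ℕ, ∀ y ∈ e c, y ≤ n) ∧
  ∀ x : ℕ, 1 ≤ x → x ≤ n →
    ∃ δ : YoungDiagram, IsCore (k + 1) δ ∧ δ.cells = shapeLe γ e x ∧
      ∃ i : ZMod (k + 1), (∃ c, x ∈ e c) ∧
        ∀ c : ℕ × ℕ, x ∈ e c ↔ Removable δ c ∧ residue k c = i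

/-- The alphabet `𝒜_{α,x} = {Σ^{x-1}α + 1, …, Σ^x α}`. -/
def alphaBlock (α : List ℕ) (x : ℕ) : Finset ℕ :=
  Finset.Ioc ((α.take (x - 1)).sum) ((α.take x).sum)

/-- `c` is the lowest occurrence of the letter `y`. -/
def IsLowestOcc (e : ℕ × ℕ → Finset ℕ) (y : ℕ) (c : ℕ × ℕ) : Prop :=
  y ∈ e c ∧ ∀ d : ℕ × ℕ, y ∈ e d → c.1 ≤ d.1

/-- `a` comes strictly before `b` in the reading order (top to bottom, left to right;
higher rows of the Ferrers shape have larger first coordinate here). -/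
def ReadBefore (a b : ℕ × ℕ) : Prop :=
  b.1 < a.1 ∨ (a.1 = b.1 ∧ a.2 < b.2)

/-- An affine set-valued tableau of weight `α` and shape `γ`: a standard affine set-valued
tableau of degree `|α|` such that for each `x`, the lowest reading word in `𝒜_{α,x}` is
increasing, the letters of `𝒜_{α,x}` occupy exactly `α_x` distinct residues, and they form a
horizontal strip. -/
def IsASVT (k : ℕ) (α : List ℕ) (γ : YoungDiagram) (e : ℕ × ℕ → Finset ℕ) : Prop :=
  IsStdASVT k α.sum γ e ∧
  ∀ x : ℕ, 1 ≤ x → x ≤ α.length →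
    (∀ y z : ℕ, y ∈ alphaBlock α x → z ∈ alphaBlock α x → y < z →
      ∀ cy cz : ℕ × ℕ, IsLowestOcc e y cy → IsLowestOcc e z cz → ReadBefore cy cz) ∧
    (((γ.cells.filter fun c => ∃ y ∈ alphaBlock α x, y ∈ e c).image (residue k)).card
        = α.getD (x - 1) 0) ∧
    (∀ c d : ℕ × ℕ, (∃ y ∈ alphaBlock α x, y ∈ e c) → (∃ y ∈ alphaBlock α x, y ∈ e d) →
      c.2 = d.2 → c = d)

/-- `𝒦^{(k)}_{λα}`: the number of affine set-valued tableaux of shape `𝔠(λ)` and weight `α`. -/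
noncomputable def Kcal (k : ℕ) (lam : YoungDiagram) (α : List ℕ) : ℕ :=
  Nat.card {e : ℕ × ℕ → Finset ℕ // IsASVT k α (coreOf k lam) e}

/-- A `k`-tableau of shape `γ` and weight `α`: a semistandard filling with letters `1,…,ℓ(α)`
(recorded as `0` outside `γ`) in which the letter `i` occupies exactly `α_i` distinct residues. -/
def IsKTab (k : ℕ) (α : List ℕ) (γ : YoungDiagram) (u : ℕ × ℕ → ℕ) : Prop :=
  (∀ c : ℕ × ℕ, c ∈ γ ↔ u c ≠ 0) ∧
  (∀ c : ℕ × ℕ, u c ≤ α.length) ∧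
  (∀ r c : ℕ, (r, c) ∈ γ → (r + 1, c) ∈ γ → u (r, c) < u (r + 1, c)) ∧
  (∀ r c : ℕ, (r, c) ∈ γ → (r, c + 1) ∈ γ → u (r, c) ≤ u (r, c + 1)) ∧
  ∀ i : ℕ, 1 ≤ i → i ≤ α.length →
    ((γ.cells.filter fun c => u c = i).image (residue k)).card = α.getD (i - 1) 0

/-- `K^{(k)}_{λα}`: the number of `k`-tableaux of shape `𝔠(λ)` and weight `α`. -/
noncomputable def Kktab (k : ℕ) (lam : YoungDiagram) (α : List ℕ) : ℕ :=
  Nat.card {u : ℕ × ℕ → ℕ // IsKTab k α (coreOf k lam) u}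

/-- A plain set-valued tableau of shape `λ` and weight `α`. -/
def IsSVT (α : List ℕ) (lam : YoungDiagram) (e : ℕ × ℕ → Finset ℕ) : Prop :=
  IsSVFilling lam e ∧ (∀ c : ℕ × ℕ, ∀ x ∈ e c, x ≤ α.length) ∧
  ∀ i : ℕ, 1 ≤ i → i ≤ α.length →
    (lam.cells.filter fun c => i ∈ e c).card = α.getD (i - 1) 0

/-- `𝒦_{λα}`: the number of set-valued tableaux of shape `λ` and weight `α`. -/
noncomputable def KcalSV (lam : YoungDiagram) (α : List ℕ) : ℕ :=
  Nat.card {e : ℕ × ℕ → Finset ℕ // IsSVT α lam e}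


/-! ## The ring of symmetric functions, realized as `Λ ≅ ℤ[h₁, h₂, …]`,
the free polynomial ring on the complete homogeneous symmetric functions
(variable `n` is `h_{n+1}`). -/

abbrev SymFunc := MvPolynomial ℕ ℤ

/-- The complete homogeneous symmetric function `h_r` (`h_0 = 1`). -/
noncomputable def hSym : ℕ → SymFunc
  | 0 => 1
  | n + 1 => MvPolynomial.X n

/-- The elementary symmetric function
`e_n = Σ_{α ⊨ n} (-1)^{n - ℓ(α)} h_α` (sum over compositions of `n`). -/
noncomputable def eSym (n : ℕ) : SymFunc :=
  ∑ c : Composition n, (-1 : SymFunc) ^ (n - c.length) * (c.blocks.map hSym).prod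

/-- `h_λ = h_{λ_1} ⋯ h_{λ_ℓ}` for a partition `λ`. -/
noncomputable def hProd (lam : YoungDiagram) : SymFunc :=
  (lam.rowLens.map hSym).prod

/-- `Λ^{(k)} = ℤ[h_1, …, h_k]` as a subalgebra of `Λ`. -/
noncomputable def LambdaK (k : ℕ) : Subalgebra ℤ SymFunc :=
  MvPolynomial.supported ℤ {n : ℕ | n < k}

/-- The exponent vector of the monomial `h_λ` in the `h`-presentation of `Λ`. -/
noncomputable def hExp (lam : YoungDiagram) : ℕ →₀ ℕ :=
  Multiset.toFinsupp ((lam.rowLens : Multiset ℕ).map fun r => r - 1)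

/-- The coefficient of `h_λ` in the expansion of `p ∈ Λ` in the basis `{h_λ}`. -/
noncomputable def hCoeff (p : SymFunc) (lam : YoungDiagram) : ℤ :=
  MvPolynomial.coeff (hExp lam) p

/-- The Hall inner product `⟨p, F⟩` of `p ∈ Λ` with a (degree-wise finite) formal series
`F = Σ_ν F(ν) m_ν` in the monomial symmetric functions, characterized by
`⟨h_λ, m_μ⟩ = δ_{λμ}`. -/
noncomputable def hallPair (p : SymFunc) (F : YoungDiagram → ℤ) : ℤ :=
  ∑ᶠ ν : YoungDiagram, hCoeff p ν * F ν

/-- The column dual Grothendieck polynomial `g_{1^m} = Σ_{j=1}^m binom(m-1, j-1) e_j`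
(`g_{1^0} = 1`). -/
noncomputable def gColumn (m : ℕ) : SymFunc :=
  if m = 0 then 1 else ∑ j ∈ Finset.Icc 1 m, (((m - 1).choose (j - 1) : ℤ)) • eSym j

/-- The algebra endomorphism `Ω` of `Λ` with `Ω(h_ℓ) = Σ_{j=1}^ℓ binom(ℓ-1, j-1) e_j`. -/
noncomputable def OmegaMap : SymFunc →ₐ[ℤ] SymFunc :=
  MvPolynomial.aeval fun n => gColumn (n + 1)

/-- Generalized binomial coefficient `C(n, j)` for an arbitrary integer `n`. -/
def genBinom (n : ℤ) (j : ℕ) : ℤ :=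
  if 0 ≤ n then (n.toNat.choose j : ℤ) else (-1) ^ j * ((j + (-n - 1).toNat).choose j : ℤ)



/-! ## The defining systems for (k-K-)Schur-type bases -/

/-- `g` is the family of `k`-`K`-Schur functions: the unique elements of `Λ^{(k)}` with
`h_λ = Σ_{μ ∈ 𝒫^k, |μ| ≤ |λ|} (-1)^{|λ|+|μ|} 𝒦^{(k)}_{μλ} g^{(k)}_μ` for all `λ ∈ 𝒫^k`. -/
def KKSchurSystem (k : ℕ) (g : YoungDiagram → SymFunc) : Prop :=
  (∀ lam : YoungDiagram, IsKBounded k lam → g lam ∈ LambdaK k) ∧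
  ∀ lam : YoungDiagram, IsKBounded k lam →
    hProd lam = ∑ᶠ μ : YoungDiagram,
      if IsKBounded k μ ∧ μ.card ≤ lam.card then
        ((-1 : ℤ) ^ (lam.card + μ.card) * (Kcal k μ lam.rowLens : ℤ)) • g μ
      else 0

/-- `gd` is the family of dual Grothendieck polynomials: determined by
`h_μ = Σ_{|λ| ≤ |μ|} (-1)^{|λ|+|μ|} 𝒦_{λμ} g_λ` for all partitions `μ`. -/
def DualGrothSystem (gd : YoungDiagram → SymFunc) : Prop :=
  ∀ mu : YoungDiagram,
    hProd mu = ∑ᶠ lam : YoungDiagram,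
      if lam.card ≤ mu.card then
        ((-1 : ℤ) ^ (lam.card + mu.card) * (KcalSV lam mu.rowLens : ℤ)) • gd lam
      else 0

/-- `s` is the family of `k`-Schur functions: the unique elements of `Λ^{(k)}` with
`h_λ = s^{(k)}_λ + Σ_{μ ⊳ λ} K^{(k)}_{μλ} s^{(k)}_μ` for all `λ ∈ 𝒫^k`. -/
def KSchurSystem (k : ℕ) (s : YoungDiagram → SymFunc) : Prop :=
  (∀ lam : YoungDiagram, IsKBounded k lam → s lam ∈ LambdaK k) ∧
  ∀ lam : YoungDiagram, IsKBounded k lam →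
    hProd lam = s lam + ∑ᶠ μ : YoungDiagram,
      if IsKBounded k μ ∧ Dominates μ lam ∧ μ ≠ lam then
        (Kktab k μ lam.rowLens : ℤ) • s μ
      else 0


/-! ## Coefficient series of affine Grothendieck polynomials and dual k-Schur functions -/

/-- The coefficient of `m_ν` in the affine Grothendieck polynomial
`G^{(k)}_λ = Σ_{μ ∈ 𝒫^k} (-1)^{|λ|+|μ|} 𝒦^{(k)}_{λμ} m_μ`
(a degree-wise finite formal series in the monomial symmetric functions). -/
noncomputable def Gcoeff (k : ℕ) (lam ν : YoungDiagram) : ℤ :=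
  if IsKBounded k ν then (-1) ^ (lam.card + ν.card) * (Kcal k lam ν.rowLens : ℤ) else 0

/-- The coefficient of `m_ν` in the dual `k`-Schur function
`𝔖^{(k)}_λ = Σ_{μ ∈ 𝒫^k} K^{(k)}_{λμ} m_μ`. -/
noncomputable def dualKSchurCoeff (k : ℕ) (lam ν : YoungDiagram) : ℤ :=
  if IsKBounded k ν then (Kktab k lam ν.rowLens : ℤ) else 0

/-- `blockOf α y = x` when `y ∈ 𝒜_{α,x}`: the map replacing each letter of `𝒜_{α,x}` by `x`. -/
noncomputable def blockOf (α : List ℕ) (y : ℕ) : ℕ :=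
  sInf {x : ℕ | y ≤ (α.take x).sum}
/-! ## Beta sets and hook lengths -/

theorem hookLen_add_eq {γ : YoungDiagram} {r c : ℕ} (h : (r, c) ∈ γ) :
    hookLen γ r c + c + r + 1 = γ.rowLen r + γ.colLen c := by
  have h₁ := YoungDiagram.mem_iff_lt_rowLen.1 h
  have h₂ := YoungDiagram.mem_iff_lt_colLen.1 h
  unfold hookLen
  omega

theorem mem_iff_colLen_lt {γ : YoungDiagram} {r c : ℕ} :
    (r, c) ∈ γ ↔ (c : ℤ) - γ.colLen c + 1 < (γ.rowLen r : ℤ) - r := by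
  have h₁ : (r, c) ∈ γ ↔ c < γ.rowLen r := YoungDiagram.mem_iff_lt_rowLen
  have h₂ : (r, c) ∈ γ ↔ r < γ.colLen c := YoungDiagram.mem_iff_lt_colLen
  by_cases h : (r, c) ∈ γ
  · have := h₁.1 h
    have := h₂.1 h
    simp only [h, true_iff]
    omega
  · rw [h₁] at h
    have h' := h
    rw [← h₁, h₂] at h'
    simp only [h₁, h, false_iff]
    omega

/-- Every integer is the content just past the end of a row or just past the end of a column. -/
theorem exists_row_or_col (γ : YoungDiagram) (x : ℤ) :
    (∃ r : ℕ, (γ.rowLen r : ℤ) - r = x) ∨ ∃ c : ℕ, (c : ℤ) - γ.colLen c + 1 = x := by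
  have hex : ∃ r : ℕ, (γ.rowLen r : ℤ) - r ≤ x := by
    refine ⟨((γ.rowLen 0 : ℤ) - x).toNat, ?_⟩
    have := γ.rowLen_anti 0 ((γ.rowLen 0 : ℤ) - x).toNat (Nat.zero_le _)
    omega
  have hr := Nat.find_spec hex
  have hmin := fun m => Nat.find_min hex (m := m)
  generalize Nat.find hex = r at hr hmin
  rcases hr.eq_or_lt with h | h
  · exact Or.inl ⟨r, h⟩
  · right
    refine ⟨(x + r - 1).toNat, ?_⟩
    have hle : γ.colLen (x + r - 1).toNat ≤ r := by
      by_contra! hlt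
      have := YoungDiagram.mem_iff_lt_rowLen.1 (YoungDiagram.mem_iff_lt_colLen.2 hlt)
      omega
    have hge : r ≤ γ.colLen (x + r - 1).toNat := by
      rcases r with _ | s
      · exact Nat.zero_le _
      · have hs := hmin s (Nat.lt_succ_self s)
        refine YoungDiagram.mem_iff_lt_colLen.1 (YoungDiagram.mem_iff_lt_rowLen.2 ?_)
        push_cast at hs ⊢
        omega
    omega

theorem IsCore.exists_row_sub {p : ℕ} {γ : YoungDiagram} (hγ : IsCore p γ) (hp : 1 ≤ p)
    (r m : ℕ) : ∃ t : ℕ, (γ.rowLen t : ℤ) - t = (γ.rowLen r : ℤ) - r - p * m := by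
  induction m with
  | zero => exact ⟨r, by simp⟩
  | succ m ih =>
    obtain ⟨s, hs⟩ := ih
    rcases exists_row_or_col γ ((γ.rowLen s : ℤ) - s - p) with ⟨t, ht⟩ | ⟨c, hc⟩
    · exact ⟨t, by rw [ht, hs]; push_cast; ring⟩
    · have hmem : (s, c) ∈ γ := mem_iff_colLen_lt.2 (by omega)
      have := hookLen_add_eq hmem
      exact absurd (by dsimp only; omega) (hγ (s, c) hmem)

/-! ## Adding corners of one residue to a core -/

theorem dvd_of_residue_eq {k r c s d : ℕ} (h : residue k (r, c) = residue k (s, d)) :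
    ((k + 1 : ℕ) : ℤ) ∣ ((c : ℤ) - r) - ((d : ℤ) - s) := by
  rw [← ZMod.intCast_eq_intCast_iff_dvd_sub]
  simpa [residue] using h.symm

theorem rowLen_le_of_le {γ δ : YoungDiagram} (h : γ ≤ δ) (r : ℕ) : γ.rowLen r ≤ δ.rowLen r := by
  by_contra! hlt
  exact lt_irrefl _ (YoungDiagram.mem_iff_lt_rowLen.1 (h (YoungDiagram.mem_iff_lt_rowLen.2 hlt)))

theorem colLen_le_of_le {γ δ : YoungDiagram} (h : γ ≤ δ) (c : ℕ) : γ.colLen c ≤ δ.colLen c := by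
  by_contra! hlt
  exact lt_irrefl _ (YoungDiagram.mem_iff_lt_colLen.1 (h (YoungDiagram.mem_iff_lt_colLen.2 hlt)))

section AddCorners

variable {k : ℕ} {γ δ : YoungDiagram} {i : ZMod (k + 1)}

theorem rowLen_eq_or_of_corners (hle : γ ≤ δ)
    (hnew : ∀ c ∈ δ, c ∉ γ → Removable δ c ∧ residue k c = i) (r : ℕ) :
    δ.rowLen r = γ.rowLen r ∨
      δ.rowLen r = γ.rowLen r + 1 ∧ residue k (r, γ.rowLen r) = i := by
  rcases (rowLen_le_of_le hle r).eq_or_lt with h | h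
  · exact Or.inl h.symm
  · obtain ⟨hrem, hres⟩ := hnew (r, γ.rowLen r) (YoungDiagram.mem_iff_lt_rowLen.2 h)
      (fun h' => lt_irrefl _ (YoungDiagram.mem_iff_lt_rowLen.1 h'))
    have := hrem.2.2
    rw [YoungDiagram.mem_iff_lt_rowLen] at this
    dsimp only at this
    exact Or.inr ⟨by omega, hres⟩

/-- When two corners of the same residue are added to a core, the row of the lower one contains
a cell whose hook length ceases to be `k`-bounded. -/
theorem exists_hookLen_gt_of_corners (hk : 1 ≤ k) (hγ : IsCore (k + 1) γ) (hle : γ ≤ δ)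
    (hnew : ∀ c ∈ δ, c ∉ γ → Removable δ c ∧ residue k c = i) {r s : ℕ} (hrs : r < s)
    (hr : γ.rowLen r < δ.rowLen r) (hs : γ.rowLen s < δ.rowLen s) :
    ∃ c, (r, c) ∈ γ ∧ hookLen γ r c ≤ k ∧ k < hookLen δ r c := by
  have key := rowLen_eq_or_of_corners hle hnew
  obtain ⟨hr, hri⟩ := (key r).resolve_left hr.ne'
  obtain ⟨hs, hsi⟩ := (key s).resolve_left hs.ne'
  obtain ⟨m, hm⟩ := dvd_of_residue_eq (hri.trans hsi.symm)
  have hanti := δ.rowLen_anti r s hrs.le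
  rcases exists_row_or_col γ ((γ.rowLen r : ℤ) + 1 - r - (k + 1 : ℕ)) with ⟨t, ht⟩ | ⟨c, hc⟩
  · exfalso
    have hmpos : 0 < m := by
      by_contra! hneg
      have := mul_nonpos_of_nonneg_of_nonpos (Int.natCast_nonneg (k + 1)) hneg
      omega
    obtain ⟨u, hu⟩ := hγ.exists_row_sub (Nat.le_add_left 1 k) t (m - 1).toNat
    rw [ht, Int.toNat_of_nonneg (by omega), mul_sub, mul_one, ← hm] at hu
    have hus : u < s := by
      by_contra! h
      have := γ.rowLen_anti s u h
      omega
    have hδu := δ.rowLen_anti u s hus.le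
    rcases key u with h | ⟨h, hui⟩
    · omega
    · obtain ⟨q, hq⟩ := dvd_of_residue_eq (hui.trans hsi.symm)
      have h1 : ((k + 1 : ℕ) : ℤ) ∣ 1 := ⟨q, by rw [← hq]; omega⟩
      have := Int.le_of_dvd one_pos h1
      omega
  · have hmem : (r, c) ∈ γ := mem_iff_colLen_lt.2 (by push_cast at hc; omega)
    have h₁ := hookLen_add_eq hmem
    have h₂ := hookLen_add_eq (hle hmem)
    have h₃ := colLen_le_of_le hle c
    exact ⟨c, hmem, by omega, by omega⟩

theorem pSize_le_succ_of_corners (hk : 1 ≤ k) (hγ : IsCore (k + 1) γ) (hle : γ ≤ δ)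
    (hnew : ∀ c ∈ δ, c ∉ γ → Removable δ c ∧ residue k c = i) :
    pSize k δ ≤ pSize k γ + 1 := by
  unfold pSize
  set S := δ.cells.filter fun c => hookLen δ c.1 c.2 ≤ k
  set S' := γ.cells.filter fun c => hookLen γ c.1 c.2 ≤ k with hS'
  set N := δ.cells \ γ.cells with hN
  have hNmem : ∀ c ∈ N, γ.rowLen c.1 < δ.rowLen c.1 ∧ c.2 = γ.rowLen c.1 := by
    rintro ⟨r, c⟩ hc
    rw [hN, Finset.mem_sdiff, YoungDiagram.mem_cells, YoungDiagram.mem_cells,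
      YoungDiagram.mem_iff_lt_rowLen, YoungDiagram.mem_iff_lt_rowLen] at hc
    rcases rowLen_eq_or_of_corners hle hnew r with h | ⟨h, -⟩ <;> dsimp only <;> omega
  have hNinj : Set.InjOn Prod.fst (N : Set (ℕ × ℕ)) := by
    intro a ha b hb hab
    have h₁ := (hNmem a ha).2
    have h₂ := (hNmem b hb).2
    exact Prod.ext hab (by rw [h₁, h₂, hab])
  have hsub : S \ S' ⊆ N := by
    rintro ⟨r, c⟩ hc
    simp only [S, hS', hN, Finset.mem_sdiff, Finset.mem_filter, YoungDiagram.mem_cells] at hc ⊢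
    refine ⟨hc.1.1, fun hmem => hc.2 ⟨hmem, ?_⟩⟩
    have h₁ := hookLen_add_eq hmem
    have h₂ := hookLen_add_eq (hle hmem)
    have h₃ := colLen_le_of_le hle c
    have h₄ := rowLen_le_of_le hle r
    omega
  have hcard : N.card ≤ (S' \ S).card + 1 := by
    rcases N.eq_empty_or_nonempty with h | hne
    · simp [h]
    · have hne' : (N.image Prod.fst).Nonempty := hne.image _
      set s := (N.image Prod.fst).max' hne' with hs
      have hsmem := (N.image Prod.fst).max'_mem hne'
      rw [← hs] at hsmem
      have himg : (N.image Prod.fst).erase s ⊆ (S' \ S).image Prod.fst := by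
        intro r hr
        obtain ⟨hrs, hr⟩ := Finset.mem_erase.1 hr
        have hlt : r < s := lt_of_le_of_ne (Finset.le_max' _ _ hr) hrs
        obtain ⟨a, ha, rfl⟩ := Finset.mem_image.1 hr
        obtain ⟨b, hb, hbs⟩ := Finset.mem_image.1 hsmem
        obtain ⟨c, hc, hc₁, hc₂⟩ := exists_hookLen_gt_of_corners hk hγ hle hnew hlt
          (hNmem a ha).1 (hbs ▸ (hNmem b hb).1)
        refine Finset.mem_image.2 ⟨(a.1, c), ?_, rfl⟩
        simp only [S, hS', Finset.mem_sdiff, Finset.mem_filter, YoungDiagram.mem_cells]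
        exact ⟨⟨hc, hc₁⟩, fun h => absurd h.2 (not_le.2 hc₂)⟩
      have h₁ := Finset.card_le_card himg
      rw [Finset.card_erase_of_mem hsmem, Finset.card_image_of_injOn hNinj] at h₁
      have h₂ : ((S' \ S).image Prod.fst).card ≤ _ := Finset.card_image_le
      omega
  have h₁ := Finset.card_le_card hsub
  have h₂ := Finset.card_sdiff_add_card_inter S S'
  have h₃ := Finset.card_sdiff_add_card_inter S' S
  rw [Finset.inter_comm] at h₃
  omega

end AddCorners

theorem IsStdASVT.pSize_le {k n : ℕ} {γ : YoungDiagram} {e : ℕ × ℕ → Finset ℕ} (hk : 1 ≤ k)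
    (h : IsStdASVT k n γ e) : pSize k γ ≤ n := by
  obtain ⟨⟨hne, hpos, -, -⟩, hn, hstd⟩ := h
  have main : ∀ x ≤ n, ∃ δ : YoungDiagram, IsCore (k + 1) δ ∧ δ.cells = shapeLe γ e x ∧
      pSize k δ ≤ x := by
    intro x
    induction x with
    | zero =>
      intro _
      refine ⟨⊥, fun c hc => absurd hc (YoungDiagram.notMem_bot c), ?_, by simp [pSize]⟩
      symm
      rw [YoungDiagram.cells_bot, shapeLe, Finset.filter_eq_empty_iff]
      rintro c - ⟨y, hy, hy0⟩
      exact absurd (hpos c y hy) (not_lt.2 hy0)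
    | succ x ih =>
      intro hx
      obtain ⟨δ', hcore', hcells', hsize'⟩ := ih (by omega)
      obtain ⟨δ, hcore, hcells, i, -, hi⟩ := hstd (x + 1) (by omega) hx
      have hmem : ∀ c, c ∈ δ ↔ c ∈ γ ∧ ∃ y ∈ e c, y ≤ x + 1 := fun c => by
        rw [← YoungDiagram.mem_cells, hcells, shapeLe, Finset.mem_filter, YoungDiagram.mem_cells]
      have hmem' : ∀ c, c ∈ δ' ↔ c ∈ γ ∧ ∃ y ∈ e c, y ≤ x := fun c => by
        rw [← YoungDiagram.mem_cells, hcells', shapeLe, Finset.mem_filter, YoungDiagram.mem_cells]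
      refine ⟨δ, hcore, hcells, (pSize_le_succ_of_corners (i := i) hk hcore' ?_ ?_).trans
        (Nat.succ_le_succ hsize')⟩
      · intro c hc
        obtain ⟨hc, y, hy, hyx⟩ := (hmem' c).1 hc
        exact (hmem c).2 ⟨hc, y, hy, by omega⟩
      · intro c hc hc'
        obtain ⟨hcγ, y, hy, hyx⟩ := (hmem c).1 hc
        rcases hyx.eq_or_lt with rfl | hlt
        · exact (hi c).1 hy
        · exact absurd ((hmem' c).2 ⟨hcγ, y, hy, by omega⟩) hc'
  obtain ⟨δ, -, hcells, hsize⟩ := main n le_rfl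
  have : δ = γ := by
    refine YoungDiagram.ext ?_
    rw [hcells, shapeLe, Finset.filter_eq_self]
    intro c hc
    obtain ⟨y, hy⟩ := (hne c).1 hc
    exact ⟨y, hy, hn c y hy⟩
  exact this ▸ hsize

/-! ## The core of a `k`-bounded partition -/

/-- Row lengths of the `(k+1)`-core of `lam`: row `r` exceeds row `r + (k + 1 - λ_r)` by `λ_r`. -/
def coreRow (k : ℕ) (lam : YoungDiagram) (r : ℕ) : ℕ :=
  if r < lam.colLen 0 then lam.rowLen r + coreRow k lam (r + 1 + (k - lam.rowLen r)) else 0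
termination_by lam.colLen 0 - r

theorem rowLen_eq_zero {lam : YoungDiagram} {r : ℕ} (hr : lam.colLen 0 ≤ r) :
    lam.rowLen r = 0 := by
  by_contra h
  exact absurd (YoungDiagram.mem_iff_lt_colLen.1
    (YoungDiagram.mem_iff_lt_rowLen.2 (Nat.pos_of_ne_zero h))) (not_lt.2 hr)

theorem coreRow_eq_zero (k : ℕ) {lam : YoungDiagram} {r : ℕ} (hr : lam.colLen 0 ≤ r) :
    coreRow k lam r = 0 := by
  rw [coreRow, if_neg (not_lt.2 hr)]

theorem coreRow_eq (k : ℕ) (lam : YoungDiagram) (r : ℕ) :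
    coreRow k lam r = lam.rowLen r + coreRow k lam (r + 1 + (k - lam.rowLen r)) := by
  by_cases hr : r < lam.colLen 0
  · rw [coreRow, if_pos hr]
  · rw [not_lt] at hr
    rw [coreRow_eq_zero k hr, rowLen_eq_zero hr, coreRow_eq_zero k (by omega)]

theorem coreRow_antitone (k : ℕ) (lam : YoungDiagram) (hlam : IsKBounded k lam) :
    Antitone (coreRow k lam) := by
  suffices H : ∀ n r s : ℕ, lam.colLen 0 ≤ r + n → r ≤ s → coreRow k lam s ≤ coreRow k lam r from
    fun r s hrs => H (lam.colLen 0) r s (by omega) hrs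
  intro n
  induction n with
  | zero =>
    intro r s hr hrs
    rw [coreRow_eq_zero k (by omega : lam.colLen 0 ≤ s)]
    exact Nat.zero_le _
  | succ n ih =>
    intro r s hr hrs
    rcases hrs.eq_or_lt with rfl | hlt
    · exact le_rfl
    · rw [coreRow_eq k lam s, coreRow_eq k lam r]
      have h₁ := lam.rowLen_anti r s hrs
      have := hlam r
      exact Nat.add_le_add h₁ (ih _ _ (by omega) (by omega))

/-- The Young diagram with rows `coreRow k lam`. -/
def coreDiagram (k : ℕ) (lam : YoungDiagram) (hlam : IsKBounded k lam) : YoungDiagram where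
  cells := (Finset.range (lam.colLen 0) ×ˢ Finset.range (coreRow k lam 0)).filter
    fun c => c.2 < coreRow k lam c.1
  isLowerSet := by
    rintro ⟨r, c⟩ ⟨s, d⟩ ⟨hsr, hdc⟩ h
    dsimp only at hsr hdc
    simp only [Finset.coe_filter, Finset.mem_product, Finset.mem_range, Set.mem_ofPred_eq] at h ⊢
    have := coreRow_antitone k lam hlam hsr
    omega

theorem rowLen_coreDiagram (k : ℕ) (lam : YoungDiagram) (hlam : IsKBounded k lam) (r : ℕ) :
    (coreDiagram k lam hlam).rowLen r = coreRow k lam r := by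
  refine eq_of_forall_lt_iff fun c => ?_
  rw [← YoungDiagram.mem_iff_lt_rowLen, ← YoungDiagram.mem_cells, coreDiagram]
  simp only [Finset.mem_filter, Finset.mem_product, Finset.mem_range, and_iff_right_iff_imp]
  intro h
  have := coreRow_antitone k lam hlam (Nat.zero_le r)
  refine ⟨?_, by omega⟩
  by_contra! hr
  rw [coreRow_eq_zero k hr] at h
  omega

theorem exists_core (k : ℕ) (lam : YoungDiagram) (hlam : IsKBounded k lam) :
    ∃ γ, IsCore (k + 1) γ ∧ ∀ i, pRow k γ i = lam.rowLen i := by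
  set γ := coreDiagram k lam hlam
  have hrow : ∀ r, γ.rowLen r = coreRow k lam r := rowLen_coreDiagram k lam hlam
  have hshort : ∀ r c, (r, c) ∈ γ → coreRow k lam (r + 1 + (k - lam.rowLen r)) ≤ c →
      hookLen γ r c ≤ k := by
    intro r c hmem hc
    have h₁ := hookLen_add_eq hmem
    have h₂ : ¬ (r + 1 + (k - lam.rowLen r), c) ∈ γ := by
      rw [YoungDiagram.mem_iff_lt_rowLen, hrow]
      omega
    rw [YoungDiagram.mem_iff_lt_colLen] at h₂
    have := hlam r
    have := coreRow_eq k lam r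
    rw [hrow] at h₁
    omega
  have hlong : ∀ r c, c < coreRow k lam (r + 1 + (k - lam.rowLen r)) →
      (r, c) ∈ γ ∧ k + 1 < hookLen γ r c := by
    intro r c hc
    have := coreRow_eq k lam r
    have := hlam r
    have hmem : (r, c) ∈ γ := by
      rw [YoungDiagram.mem_iff_lt_rowLen, hrow]
      omega
    have h₁ := hookLen_add_eq hmem
    have h₂ : (r + 1 + (k - lam.rowLen r), c) ∈ γ := by
      rw [YoungDiagram.mem_iff_lt_rowLen, hrow]
      omega
    rw [YoungDiagram.mem_iff_lt_colLen] at h₂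
    rw [hrow] at h₁
    exact ⟨hmem, by omega⟩
  refine ⟨γ, ?_, fun r => ?_⟩
  · rintro ⟨r, c⟩ hmem
    dsimp only
    rcases lt_or_ge c (coreRow k lam (r + 1 + (k - lam.rowLen r))) with h | h
    · have := (hlong r c h).2
      omega
    · have := hshort r c hmem h
      omega
  · have himg : (γ.cells.filter fun c => c.1 = r ∧ hookLen γ c.1 c.2 ≤ k) =
        {r} ×ˢ Finset.Ico (coreRow k lam (r + 1 + (k - lam.rowLen r))) (coreRow k lam r) := by
      ext ⟨s, c⟩
      simp only [Finset.mem_filter, YoungDiagram.mem_cells, Finset.mem_product,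
        Finset.mem_singleton, Finset.mem_Ico]
      constructor
      · rintro ⟨hmem, rfl, hook⟩
        refine ⟨rfl, ?_, ?_⟩
        · by_contra! h
          have := (hlong s c h).2
          omega
        · rw [← hrow]
          exact YoungDiagram.mem_iff_lt_rowLen.1 hmem
      · rintro ⟨rfl, h₁, h₂⟩
        have hmem : (s, c) ∈ γ := by rwa [YoungDiagram.mem_iff_lt_rowLen, hrow]
        exact ⟨hmem, rfl, hshort s c hmem h₁⟩
    have := coreRow_eq k lam r
    rw [pRow, himg, Finset.card_product, Finset.card_singleton, Nat.card_Ico]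
    omega

theorem sum_rowLen_eq_card (lam : YoungDiagram) {n : ℕ} (hn : lam.colLen 0 ≤ n) :
    ∑ r ∈ Finset.range n, lam.rowLen r = lam.card := by
  rw [YoungDiagram.card, Finset.card_eq_sum_card_fiberwise (f := Prod.fst) (t := Finset.range n)]
  · refine Finset.sum_congr rfl fun r _ => ?_
    rw [YoungDiagram.rowLen_eq_card]
    rfl
  · rintro ⟨r, c⟩ h
    have := YoungDiagram.mem_iff_lt_colLen.1 ((YoungDiagram.mem_cells _).1 h)
    have := lam.colLen_anti 0 c (Nat.zero_le c)
    simp only [Finset.coe_range, Set.mem_Iio]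
    omega

theorem sum_pRow_eq_pSize (k : ℕ) (γ : YoungDiagram) {n : ℕ} (hn : γ.colLen 0 ≤ n) :
    ∑ r ∈ Finset.range n, pRow k γ r = pSize k γ := by
  rw [pSize, Finset.card_eq_sum_card_fiberwise (f := Prod.fst) (t := Finset.range n)]
  · refine Finset.sum_congr rfl fun r _ => ?_
    rw [pRow, Finset.filter_filter]
    congr 1
    exact Finset.filter_congr fun c _ => and_comm
  · rintro ⟨r, c⟩ h
    have := YoungDiagram.mem_iff_lt_colLen.1
      ((YoungDiagram.mem_cells _).1 (Finset.mem_filter.1 h).1)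
    have := γ.colLen_anti 0 c (Nat.zero_le c)
    simp only [Finset.coe_range, Set.mem_Iio]
    omega

theorem pSize_coreOf {k : ℕ} {lam : YoungDiagram} (hlam : IsKBounded k lam) :
    pSize k (coreOf k lam) = lam.card := by
  have h := (Classical.epsilon_spec (exists_core k lam hlam)).2
  change ∀ i, pRow k (coreOf k lam) i = lam.rowLen i at h
  rw [← sum_pRow_eq_pSize k _ (le_max_left _ (lam.colLen 0)),
    ← sum_rowLen_eq_card lam (le_max_right ((coreOf k lam).colLen 0) _)]
  exact Finset.sum_congr rfl fun r _ => h r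

theorem sum_rowLens (lam : YoungDiagram) : lam.rowLens.sum = lam.card := by
  rw [← sum_rowLen_eq_card lam le_rfl, YoungDiagram.rowLens, Finset.sum_range]
  rw [← List.sum_ofFn]
  congr 1
  refine List.ext_getElem (by simp) fun i _ _ => by simp

theorem Kcal_eq_zero {k : ℕ} (hk : 1 ≤ k) {mu : YoungDiagram} (hmu : IsKBounded k mu)
    {α : List ℕ} (h : α.sum < mu.card) : Kcal k mu α = 0 := by
  have : IsEmpty {e : ℕ × ℕ → Finset ℕ // IsASVT k α (coreOf k mu) e} :=
    ⟨fun e => absurd (e.2.1.pSize_le hk) (by rw [pSize_coreOf hmu]; omega)⟩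
  exact Nat.card_of_isEmpty

/-! ## The basis `h_λ` -/

theorem hProd_eq_monomial (lam : YoungDiagram) :
    hProd lam = MvPolynomial.monomial (hExp lam) 1 := by
  suffices H : ∀ l : List ℕ, (∀ x ∈ l, 0 < x) → (l.map hSym).prod = MvPolynomial.monomial
      (Multiset.toFinsupp ((l : Multiset ℕ).map fun r => r - 1)) (1 : ℤ) from
    H _ lam.pos_of_mem_rowLens
  intro l
  induction l with
  | nil => simp
  | cons a l ih =>
    intro hl
    obtain ⟨b, rfl⟩ := Nat.exists_eq_succ_of_ne_zero (hl a (by simp)).ne'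
    rw [List.map_cons, List.prod_cons, ih fun x hx => hl x (by simp [hx]), ← Multiset.cons_coe,
      Multiset.map_cons, ← Multiset.singleton_add, map_add, Multiset.toFinsupp_singleton]
    simp [hSym, MvPolynomial.X, MvPolynomial.monomial_mul]

theorem hExp_injective : Function.Injective hExp := by
  intro lam mu h
  have h₁ := Multiset.toFinsupp.injective h
  have hrec : ∀ nu : YoungDiagram, (((nu.rowLens : Multiset ℕ).map fun r => r - 1).map
      fun r => r + 1) = nu.rowLens := fun nu => by
    rw [Multiset.map_map]
    conv_rhs => rw [← Multiset.map_id (nu.rowLens : Multiset ℕ)]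
    refine Multiset.map_congr rfl fun x hx => ?_
    have := nu.pos_of_mem_rowLens x (Multiset.mem_coe.1 hx)
    simp only [Function.comp_apply, id_eq]
    omega
  have h₂ : (lam.rowLens : Multiset ℕ) = mu.rowLens := by rw [← hrec lam, h₁, hrec mu]
  have h₃ := (Multiset.coe_eq_coe.1 h₂).eq_of_sortedGE lam.rowLens_sorted mu.rowLens_sorted
  exact YoungDiagram.equivListRowLens.injective (Subtype.ext h₃)

theorem hCoeff_hProd (lam nu : YoungDiagram) :
    hCoeff (hProd lam) nu = if lam = nu then 1 else 0 := by
  rw [hCoeff, hProd_eq_monomial, MvPolynomial.coeff_monomial]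
  simp only [hExp_injective.eq_iff]

theorem finite_setOf_card_le (n : ℕ) : {lam : YoungDiagram | lam.card ≤ n}.Finite := by
  refine Set.Finite.of_finite_image (f := YoungDiagram.cells)
    ((Finset.range n ×ˢ Finset.range n).powerset.finite_toSet.subset ?_)
    fun a _ b _ h => YoungDiagram.ext h
  rintro _ ⟨lam, hlam, rfl⟩
  simp only [Finset.coe_powerset, Set.mem_preimage, Set.mem_powerset_iff, Finset.coe_subset]
  rintro ⟨r, c⟩ h
  rw [YoungDiagram.mem_cells] at h
  have h₁ := YoungDiagram.mem_iff_lt_rowLen.1 h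
  have h₂ := YoungDiagram.mem_iff_lt_colLen.1 h
  have h₃ : lam.rowLen r ≤ lam.card := by
    rw [YoungDiagram.rowLen_eq_card]
    exact Finset.card_le_card (Finset.filter_subset _ _)
  have h₄ : lam.colLen c ≤ lam.card := by
    rw [YoungDiagram.colLen_eq_card]
    exact Finset.card_le_card (Finset.filter_subset _ _)
  simp only [Set.mem_ofPred_eq] at hlam
  simp only [Finset.mem_product, Finset.mem_range]
  omega

theorem KKSchurSystem.hProd_eq_sum {k : ℕ} (hk : 1 ≤ k) {g : YoungDiagram → SymFunc}
    (hg : KKSchurSystem k g) {F : Finset YoungDiagram} {n : ℕ}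
    (hF : ∀ ν, ν ∈ F ↔ IsKBounded k ν ∧ ν.card ≤ n) {nu : YoungDiagram} (hnu : nu ∈ F) :
    hProd nu = ∑ μ ∈ F, Gcoeff k μ nu • g μ := by
  obtain ⟨hb, hn⟩ := (hF nu).1 hnu
  rw [hg.2 nu hb, finsum_eq_sum_of_support_subset (s := F)]
  · refine Finset.sum_congr rfl fun μ hμ => ?_
    have hμb := ((hF μ).1 hμ).1
    rw [Gcoeff, if_pos hb, add_comm nu.card]
    by_cases h : μ.card ≤ nu.card
    · rw [if_pos ⟨hμb, h⟩]
    · rw [if_neg fun h' => h h'.2, Kcal_eq_zero hk hμb (by rw [sum_rowLens]; omega)]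
      simp
  · intro μ hμ
    by_contra hμF
    refine hμ (if_neg fun h => hμF ((hF μ).2 ⟨h.1, h.2.trans hn⟩))



/-- For all `k`-bounded partitions `λ` and `μ`,
`⟨g^{(k)}_λ, G^{(k)}_μ⟩ = δ_{λμ}`, where the Hall inner product of `g^{(k)}_λ` with the
degree-wise finite series `G^{(k)}_μ` is taken term by term. -/
theorem kKSchur_dual_to_affineGrothendieck
    (k : ℕ) (hk : 1 ≤ k) (g : YoungDiagram → SymFunc) (hg : KKSchurSystem k g)
    (lam mu : YoungDiagram) (hlam : IsKBounded k lam) (hmu : IsKBounded k mu) :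
    hallPair (g lam) (Gcoeff k mu) = if lam = mu then 1 else 0 := by
  set n := max lam.card mu.card
  have hfin : {ν : YoungDiagram | IsKBounded k ν ∧ ν.card ≤ n}.Finite :=
    (finite_setOf_card_le n).subset fun ν hν => hν.2
  set F := hfin.toFinset
  have hF : ∀ ν, ν ∈ F ↔ IsKBounded k ν ∧ ν.card ≤ n := fun ν => hfin.mem_toFinset
  have hcoeff : ∀ ν ∈ F, ∀ ρ,
      ∑ μ ∈ F, Gcoeff k μ ν * hCoeff (g μ) ρ = if ν = ρ then 1 else 0 := by
    intro ν hν ρ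
    rw [← hCoeff_hProd, hg.hProd_eq_sum hk hF hν, hCoeff, MvPolynomial.coeff_sum]
    exact Finset.sum_congr rfl fun μ _ => by rw [MvPolynomial.coeff_smul]; rfl
  let M : Matrix F F ℤ := fun ν μ => Gcoeff k μ ν
  let A : Matrix F F ℤ := fun μ ρ => hCoeff (g μ) ρ
  have hMA : M * A = 1 := by
    ext ν ρ
    rw [Matrix.mul_apply, Finset.sum_coe_sort F fun μ => Gcoeff k μ ν * hCoeff (g μ) ρ,
      hcoeff ν ν.2 ρ, Matrix.one_apply]
    simp only [Subtype.ext_iff]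
  have hAM : A * M = 1 := mul_eq_one_comm.1 hMA
  have hzero : ∀ ρ ∉ F, ∀ μ ∈ F, hCoeff (g μ) ρ = 0 := by
    intro ρ hρ μ hμ
    have hv : M.mulVec (fun μ : F => hCoeff (g μ) ρ) = 0 := by
      ext ν
      rw [Matrix.mulVec, dotProduct,
        Finset.sum_coe_sort F fun μ => Gcoeff k μ ν * hCoeff (g μ) ρ, hcoeff ν ν.2 ρ]
      exact if_neg fun h : (ν : YoungDiagram) = ρ => hρ (h ▸ ν.2)
    have := congrArg A.mulVec hv
    rw [Matrix.mulVec_mulVec, hAM, Matrix.one_mulVec, Matrix.mulVec_zero] at this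
    exact congrFun this ⟨μ, hμ⟩
  have hlamF : lam ∈ F := (hF lam).2 ⟨hlam, le_max_left _ _⟩
  have hmuF : mu ∈ F := (hF mu).2 ⟨hmu, le_max_right _ _⟩
  rw [hallPair, finsum_eq_sum_of_support_subset (s := F)]
  · have := congrFun (congrFun hAM ⟨lam, hlamF⟩) ⟨mu, hmuF⟩
    rw [Matrix.mul_apply, Finset.sum_coe_sort F fun ν => hCoeff (g lam) ν * Gcoeff k mu ν,
      Matrix.one_apply] at this
    simpa only [Subtype.mk.injEq] using this
  · intro ρ hρ
    by_contra h
    exact hρ (by simp only [hzero ρ h lam hlamF, zero_mul])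

end AffineKTheory
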